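/- arXiv:2410.15534 — 4 statements merged into one kernel-verified Lean document; each statement's English description precedes it below -/
import Mathlib

section
/- For every real number T, the function f : ℝ → ℝ defined by f(t) = sinh(t+T) + (t+T)/cosh(t+T) is twice differentiable and satisfies, for every real t, the equation f''(t) + (2/cosh²(t+T))·f(t) = f(t). -/
theorem hasDerivAt_sinh_add_div_cosh (T t : ℝ) :
    HasDerivAt (fun t => Real.sinh (t + T) + (t + T) / Real.cosh (t + T))
      (Real.cosh (t + T) +
        (Real.cosh (t + T) - (t + T) * Real.sinh (t + T)) / Real.cosh (t + T) ^ 2) t := by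
  have hu : HasDerivAt (fun t : ℝ => t + T) 1 t := (hasDerivAt_id t).add_const T
  refine (hu.sinh.add (hu.div hu.cosh (Real.cosh_pos _).ne')).congr_deriv ?_
  ring

theorem hasDerivAt_cosh_add_div_cosh_sq (T t : ℝ) :
    HasDerivAt (fun t => Real.cosh (t + T) +
        (Real.cosh (t + T) - (t + T) * Real.sinh (t + T)) / Real.cosh (t + T) ^ 2)
      ((1 - 2 / Real.cosh (t + T) ^ 2) *
        (Real.sinh (t + T) + (t + T) / Real.cosh (t + T))) t := by
  have hu : HasDerivAt (fun t : ℝ => t + T) 1 t := (hasDerivAt_id t).add_const T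
  have hc : Real.cosh (t + T) ≠ 0 := (Real.cosh_pos _).ne'
  refine (hu.cosh.add ((hu.cosh.sub (hu.mul hu.sinh)).div (hu.cosh.pow 2)
    (pow_ne_zero 2 hc))).congr_deriv ?_
  simp only [Pi.sub_apply, Pi.mul_apply, Pi.pow_apply]
  field_simp
  have hs := Real.sinh_sq (t + T)
  push_cast
  ring_nf at hs ⊢
  rw [hs]
  ring

theorem jacobi_solution_catenoid_mode_one_growing (T : ℝ) :
    let f : ℝ → ℝ := fun t => Real.sinh (t + T) + (t + T) / Real.cosh (t + T)
    (Differentiable ℝ f ∧ Differentiable ℝ (deriv f)) ∧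
    ∀ t : ℝ, deriv (deriv f) t + (2 / (Real.cosh (t + T)) ^ 2) * f t = f t := by
  intro f
  have hf : deriv f = _ := funext fun t => (hasDerivAt_sinh_add_div_cosh T t).deriv
  rw [hf]
  refine ⟨⟨fun t => (hasDerivAt_sinh_add_div_cosh T t).differentiableAt,
    fun t => (hasDerivAt_cosh_add_div_cosh_sq T t).differentiableAt⟩, fun t => ?_⟩
  rw [(hasDerivAt_cosh_add_div_cosh_sq T t).deriv]
  ring
end

section
/- Let T and c > 0 be real numbers, and let n ≥ 2 be an integer. The function f(t) = (n + tanh(t+T))·e^{−n(t+T)} satisfies f''(t) + (2/cosh²(t+T))·f(t) = n²·f(t) for all t ≥ 0, together with the Steklov boundary condition −(1/(c·cosh T))·f'(0) = δₙ·f(0), where δₙ = −(1 − n·cosh²T·(n + tanh T)) / (c·(n + tanh T)·cosh³T). (Note n + tanh T ≠ 0 since n ≥ 2 and |tanh T| < 1.) -/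
namespace Real

theorem inv_cosh_sq_eq_one_sub_tanh_sq (x : ℝ) : 1 / cosh x ^ 2 = 1 - tanh x ^ 2 := by
  have h := (cosh_pos x).ne'
  rw [tanh_eq_sinh_div_cosh]
  field_simp
  linarith [cosh_sq x]

theorem hasDerivAt_tanh_one_sub_sq (x : ℝ) : HasDerivAt tanh (1 - tanh x ^ 2) x := by
  have h := (cosh_pos x).ne'
  have hd := (hasDerivAt_sinh x).div (hasDerivAt_cosh x) h
  have heq : (sinh / cosh : ℝ → ℝ) = tanh := by
    ext y
    simp [tanh_eq_sinh_div_cosh]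
  rw [heq] at hd
  refine hd.congr_deriv ?_
  rw [tanh_eq_sinh_div_cosh]
  field_simp

theorem hasDerivAt_exp_neg_mul_add (a T t : ℝ) :
    HasDerivAt (fun t => exp (-(a * (t + T)))) (-a * exp (-(a * (t + T)))) t := by
  have h := ((((hasDerivAt_id t).add_const T).const_mul a).neg).exp
  refine h.congr_deriv ?_
  simp only [Pi.neg_apply, id]
  ring

theorem hasDerivAt_add_tanh_mul_exp (a T t : ℝ) :
    HasDerivAt (fun t => (a + tanh (t + T)) * exp (-(a * (t + T))))
      ((1 - tanh (t + T) ^ 2 - a * (a + tanh (t + T))) * exp (-(a * (t + T)))) t := by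
  have h := (((hasDerivAt_tanh_one_sub_sq (t + T)).comp_add_const t T).const_add a).mul
    (hasDerivAt_exp_neg_mul_add a T t)
  refine h.congr_deriv ?_
  ring

theorem hasDerivAt_deriv_add_tanh_mul_exp (a T t : ℝ) :
    HasDerivAt (deriv fun t => (a + tanh (t + T)) * exp (-(a * (t + T))))
      ((a ^ 2 - 2 * (1 - tanh (t + T) ^ 2)) * ((a + tanh (t + T)) * exp (-(a * (t + T))))) t := by
  rw [deriv_eq (hasDerivAt_add_tanh_mul_exp a T)]
  have hs := (hasDerivAt_tanh_one_sub_sq (t + T)).comp_add_const t T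
  have h := (((hs.pow 2).const_sub 1).sub ((hs.const_add a).const_mul a)).mul
    (hasDerivAt_exp_neg_mul_add a T t)
  refine h.congr_deriv ?_
  simp
  ring

end Real

theorem steklov_eigenfunction_mode_n (T c : ℝ) (hc : 0 < c) (n : ℤ) (hn : 2 ≤ n) :
    let f : ℝ → ℝ := fun t => ((n : ℝ) + Real.tanh (t + T)) * Real.exp (-((n : ℝ) * (t + T)))
    let δₙ : ℝ := -(1 - (n : ℝ) * (Real.cosh T) ^ 2 * ((n : ℝ) + Real.tanh T)) /
      (c * ((n : ℝ) + Real.tanh T) * (Real.cosh T) ^ 3)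
    (∀ t : ℝ, 0 ≤ t →
        deriv (deriv f) t + (2 / (Real.cosh (t + T)) ^ 2) * f t = (n : ℝ) ^ 2 * f t) ∧
    -(1 / (c * Real.cosh T)) * deriv f 0 = δₙ * f 0 := by
  intro f δₙ
  refine ⟨fun t _ => ?_, ?_⟩
  · have h2 : 2 / Real.cosh (t + T) ^ 2 = 2 * (1 - Real.tanh (t + T) ^ 2) := by
      rw [← Real.inv_cosh_sq_eq_one_sub_tanh_sq]
      ring
    rw [(Real.hasDerivAt_deriv_add_tanh_mul_exp n T t).deriv, h2]
    ring
  · have hC := (Real.cosh_pos T).ne'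
    have hnT : (n : ℝ) + Real.tanh T ≠ 0 := by
      have h2 : (2 : ℝ) ≤ n := by exact_mod_cast hn
      linarith [Real.neg_one_lt_tanh T]
    rw [(Real.hasDerivAt_add_tanh_mul_exp n T 0).deriv, ← Real.inv_cosh_sq_eq_one_sub_tanh_sq]
    simp only [f, δₙ, zero_add]
    field_simp
end

section
/- Let α ∈ (0, π/6). Set a₁ = 1/cos α, a₂ = 1/cos(α + 2π/3), a₃ = 1/cos(α − 2π/3) (all three cosines are nonzero on this range). Then for all real C₁, C₂, C₃ with C₁ + C₂ + C₃ = 0, one has a₁C₁² + a₂C₂² + a₃C₃² ≤ 0, and moreover there exists (C₁,C₂,C₃) ≠ (0,0,0) with C₁ + C₂ + C₃ = 0 for which a₁C₁² + a₂C₂² + a₃C₃² = 0. -/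
/-- The sum of three cosines at angles spaced by `2π/3` vanishes. -/
theorem cos_add_cos_add_cos_two_pi_div_three (α : ℝ) :
    Real.cos α + Real.cos (α + 2 * Real.pi / 3) + Real.cos (α - 2 * Real.pi / 3) = 0 := by
  have h : Real.cos (2 * Real.pi / 3) = -(1 / 2) := by
    rw [show 2 * Real.pi / 3 = Real.pi - Real.pi / 3 by ring, Real.cos_pi_sub,
      Real.cos_pi_div_three]
  rw [Real.cos_add, Real.cos_sub, h]
  ring

/-- A diagonal form with weights `1 / xᵢ`, where `x + y + z = 0`, is minus a multiple of a square
on the plane of triples with zero sum. -/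
theorem sum_sq_div_eq_neg_sq_div {x y z a b c : ℝ} (hx : x ≠ 0) (hy : y ≠ 0) (hz : z ≠ 0)
    (hsum : x + y + z = 0) (habc : a + b + c = 0) :
    1 / x * a ^ 2 + 1 / y * b ^ 2 + 1 / z * c ^ 2 =
      -((b * z - c * y) ^ 2 / (x * y * z)) := by
  obtain rfl : a = -(b + c) := by linarith
  obtain rfl : x = -(y + z) := by linarith
  have hyz : y + z ≠ 0 := neg_ne_zero.mp hx
  field_simp
  ring

theorem ynoid_first_subfamily_index_form (α : ℝ) (hα₀ : 0 < α) (hα₁ : α < Real.pi / 6) :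
    let a₁ : ℝ := 1 / Real.cos α
    let a₂ : ℝ := 1 / Real.cos (α + 2 * Real.pi / 3)
    let a₃ : ℝ := 1 / Real.cos (α - 2 * Real.pi / 3)
    (∀ C₁ C₂ C₃ : ℝ, C₁ + C₂ + C₃ = 0 →
        a₁ * C₁ ^ 2 + a₂ * C₂ ^ 2 + a₃ * C₃ ^ 2 ≤ 0) ∧
    ∃ C₁ C₂ C₃ : ℝ, (C₁, C₂, C₃) ≠ (0, 0, 0) ∧ C₁ + C₂ + C₃ = 0 ∧
      a₁ * C₁ ^ 2 + a₂ * C₂ ^ 2 + a₃ * C₃ ^ 2 = 0 := by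
  intro a₁ a₂ a₃
  have hsum := cos_add_cos_add_cos_two_pi_div_three α
  have h₁ : 0 < Real.cos α := Real.cos_pos_of_mem_Ioo ⟨by linarith, by linarith⟩
  have h₂ : Real.cos (α + 2 * Real.pi / 3) < 0 :=
    Real.cos_neg_of_pi_div_two_lt_of_lt (by linarith) (by linarith)
  have h₃ : Real.cos (α - 2 * Real.pi / 3) < 0 := by
    rw [← Real.cos_neg]
    exact Real.cos_neg_of_pi_div_two_lt_of_lt (by linarith) (by linarith)
  have key := fun {a b c : ℝ} =>
    sum_sq_div_eq_neg_sq_div (a := a) (b := b) (c := c) h₁.ne' h₂.ne h₃.ne hsum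
  refine ⟨fun C₁ C₂ C₃ hC => ?_, Real.cos α, Real.cos (α + 2 * Real.pi / 3),
    Real.cos (α - 2 * Real.pi / 3), fun h => h₁.ne' (congrArg Prod.fst h), hsum, ?_⟩
  · have hpos : 0 < Real.cos α * Real.cos (α + 2 * Real.pi / 3) *
        Real.cos (α - 2 * Real.pi / 3) :=
      mul_pos_of_neg_of_neg (mul_neg_of_pos_of_neg h₁ h₂) h₃
    rw [key hC, neg_nonpos]
    positivity
  · rw [key hsum]
    ring
end

section
/- Let α ∈ (π/6, π/3). Set a₁ = 1/cos α, a₂ = 1/cos(α + 2π/3), a₃ = 1/cos(α − 2π/3) (all three cosines are nonzero on this range). Then for all real C₁, C₂, C₃ with C₁ + C₂ + C₃ = 0, one has a₁C₁² + a₂C₂² + a₃C₃² ≥ 0, and moreover there exists (C₁,C₂,C₃) ≠ (0,0,0) with C₁ + C₂ + C₃ = 0 for which a₁C₁² + a₂C₂² + a₃C₃² = 0. -/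
/-- On the plane `x + y + z = 0`, the diagonal form with coefficients `1/p, -1/(p+q), 1/q`
is a multiple of a perfect square. -/
theorem diagonal_form_eq_sq_div {p q : ℝ} (hp : 0 < p) (hq : 0 < q) {x y z : ℝ}
    (h : x + y + z = 0) :
    1 / p * x ^ 2 + 1 / (-(p + q)) * y ^ 2 + 1 / q * z ^ 2 =
      (q * x - p * z) ^ 2 / (p * q * (p + q)) := by
  obtain rfl : y = -(x + z) := by linarith
  have hpq : p + q ≠ 0 := by positivity
  rw [one_div_neg_eq_neg_one_div]
  field_simp
  ring

theorem ynoid_second_subfamily_index_form (α : ℝ) (hα₀ : Real.pi / 6 < α)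
    (hα₁ : α < Real.pi / 3) :
    let a₁ : ℝ := 1 / Real.cos α
    let a₂ : ℝ := 1 / Real.cos (α + 2 * Real.pi / 3)
    let a₃ : ℝ := 1 / Real.cos (α - 2 * Real.pi / 3)
    (∀ C₁ C₂ C₃ : ℝ, C₁ + C₂ + C₃ = 0 →
        a₁ * C₁ ^ 2 + a₂ * C₂ ^ 2 + a₃ * C₃ ^ 2 ≥ 0) ∧
    ∃ C₁ C₂ C₃ : ℝ, (C₁, C₂, C₃) ≠ (0, 0, 0) ∧ C₁ + C₂ + C₃ = 0 ∧
      a₁ * C₁ ^ 2 + a₂ * C₂ ^ 2 + a₃ * C₃ ^ 2 = 0 := by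
  intro a₁ a₂ a₃
  have hπ := Real.pi_pos
  have hp : 0 < Real.cos α := Real.cos_pos_of_mem_Ioo ⟨by linarith, by linarith⟩
  have hq : 0 < Real.cos (α - 2 * Real.pi / 3) :=
    Real.cos_pos_of_mem_Ioo ⟨by linarith, by linarith⟩
  have hsum := cos_add_cos_add_cos_two_pi_div_three α
  have hc : Real.cos (α + 2 * Real.pi / 3) =
      -(Real.cos α + Real.cos (α - 2 * Real.pi / 3)) := by linarith
  have key : ∀ C₁ C₂ C₃ : ℝ, C₁ + C₂ + C₃ = 0 →
      a₁ * C₁ ^ 2 + a₂ * C₂ ^ 2 + a₃ * C₃ ^ 2 =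
        (Real.cos (α - 2 * Real.pi / 3) * C₁ - Real.cos α * C₃) ^ 2 /
          (Real.cos α * Real.cos (α - 2 * Real.pi / 3) *
            (Real.cos α + Real.cos (α - 2 * Real.pi / 3))) := by
    intro C₁ C₂ C₃ h
    simp only [a₁, a₂, a₃]
    rw [hc]
    exact diagonal_form_eq_sq_div hp hq h
  refine ⟨fun C₁ C₂ C₃ h => ?_, Real.cos α, Real.cos (α + 2 * Real.pi / 3),
    Real.cos (α - 2 * Real.pi / 3), fun h => hp.ne' (congrArg Prod.fst h), hsum, ?_⟩
  · rw [key _ _ _ h]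
    positivity
  · rw [key _ _ _ hsum, mul_comm, sub_self]
    simp
end
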